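/- arXiv:1901.03315 — 2 statements merged into one kernel-verified Lean document; each statement's English description precedes it below -/
import Mathlib

section
/- Let A be a real n×n matrix, B a real n×m matrix, C a real q×n matrix, C_c a real m×p matrix, D_c a real m×q matrix, let γ > 0 and τ ≥ 0, and let x⁰ ∈ ℝⁿ and x^c ∈ ℝᵖ. Set u := C_c x^c − D_c C x⁰, L := ‖A‖ + γ, L₁ := ‖B C_c‖ + γ‖C_c‖, L₂ := ‖B D_c C‖ + γ‖D_c C‖ + γ²‖D_c‖, and for s ≥ 0 define h₁(s,γ) := e^{Ls} + (e^{Ls} − 1)·L₂/L and h₂(s,γ) := (e^{Ls} − 1)·L₁/L. Suppose x : ℝ → ℝⁿ satisfies x(0) = x⁰ and, for every t ∈ [0, τ], x is differentiable at t with x'(t) = A x(t) + B u + g(t), where g : ℝ → ℝⁿ satisfies ‖g(t)‖ ≤ γ‖x(t)‖ + γ‖u‖ for all t ∈ [0, τ]. Then for every t ∈ [0, τ], ‖x(t)‖ ≤ h₁(t,γ)·‖x⁰‖ + h₂(t,γ)·‖x^c‖. -/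
open Matrix

/-- The Euclidean norm of a real vector. -/
noncomputable def vnorm {n : ℕ} (v : Fin n → ℝ) : ℝ :=
  ‖(WithLp.equiv 2 (Fin n → ℝ)).symm v‖

/-- The induced (Euclidean) operator norm of a real matrix. -/
noncomputable def mnorm {m n : ℕ} (A : Matrix (Fin m) (Fin n) ℝ) : ℝ :=
  ‖LinearMap.toContinuousLinearMap (Matrix.toEuclideanLin A)‖

lemma vnorm_nonneg' {n : ℕ} (v : Fin n → ℝ) : 0 ≤ vnorm v := norm_nonneg _

lemma mnorm_nonneg' {m n : ℕ} (A : Matrix (Fin m) (Fin n) ℝ) : 0 ≤ mnorm A := norm_nonneg _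

lemma vnorm_add_le' {n : ℕ} (v w : Fin n → ℝ) : vnorm (v + w) ≤ vnorm v + vnorm w :=
  norm_add_le (WithLp.toLp 2 v) (WithLp.toLp 2 w)

lemma vnorm_sub_le' {n : ℕ} (v w : Fin n → ℝ) : vnorm (v - w) ≤ vnorm v + vnorm w :=
  norm_sub_le (WithLp.toLp 2 v) (WithLp.toLp 2 w)

lemma vnorm_mulVec_le' {m n : ℕ} (A : Matrix (Fin m) (Fin n) ℝ) (v : Fin n → ℝ) :
    vnorm (A.mulVec v) ≤ mnorm A * vnorm v :=
  (LinearMap.toContinuousLinearMap (Matrix.toEuclideanLin A)).le_opNorm (WithLp.toLp 2 v)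

/-- Lemma 1: intersample bound for the perturbed closed-loop dynamics.  If
`x' = A x + B u + g(t)` on `[0, τ]` with `u = C_c x^c − D_c C x⁰` constant and
`‖g(t)‖ ≤ γ‖x(t)‖ + γ‖u‖`, then
`‖x(t)‖ ≤ h₁(t,γ)‖x⁰‖ + h₂(t,γ)‖x^c‖` for all `t ∈ [0, τ]`. -/
theorem intersample_bound {n m q p : ℕ}
    (A : Matrix (Fin n) (Fin n) ℝ) (B : Matrix (Fin n) (Fin m) ℝ)
    (C : Matrix (Fin q) (Fin n) ℝ) (Cc : Matrix (Fin m) (Fin p) ℝ)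
    (Dc : Matrix (Fin m) (Fin q) ℝ)
    (γ τ : ℝ) (hγ : 0 < γ) (hτ : 0 ≤ τ)
    (x0 : Fin n → ℝ) (xc : Fin p → ℝ) (u : Fin m → ℝ)
    (hu : u = Cc.mulVec xc - Dc.mulVec (C.mulVec x0))
    (L L1 L2 : ℝ)
    (hL : L = mnorm A + γ)
    (hL1 : L1 = mnorm (B * Cc) + γ * mnorm Cc)
    (hL2 : L2 = mnorm (B * Dc * C) + γ * mnorm (Dc * C) + γ ^ 2 * mnorm Dc)
    (h1 h2 : ℝ → ℝ)
    (hh1 : ∀ s, h1 s = Real.exp (L * s) + (Real.exp (L * s) - 1) * L2 / L)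
    (hh2 : ∀ s, h2 s = (Real.exp (L * s) - 1) * L1 / L)
    (x : ℝ → Fin n → ℝ) (g : ℝ → Fin n → ℝ)
    (hx0 : x 0 = x0)
    (hode : ∀ t ∈ Set.Icc (0 : ℝ) τ,
      HasDerivAt x (A.mulVec (x t) + B.mulVec u + g t) t)
    (hg : ∀ t ∈ Set.Icc (0 : ℝ) τ, vnorm (g t) ≤ γ * vnorm (x t) + γ * vnorm u) :
    ∀ t ∈ Set.Icc (0 : ℝ) τ, vnorm (x t) ≤ h1 t * vnorm x0 + h2 t * vnorm xc := by
  intro t ht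
  have hA := mnorm_nonneg' A
  have hLpos : 0 < L := by rw [hL]; linarith
  have hu1 : vnorm u ≤ mnorm Cc * vnorm xc + mnorm (Dc * C) * vnorm x0 := by
    rw [hu, Matrix.mulVec_mulVec]
    exact (vnorm_sub_le' _ _).trans (add_le_add (vnorm_mulVec_le' _ _) (vnorm_mulVec_le' _ _))
  have hBu : vnorm (B.mulVec u) ≤ mnorm (B * Cc) * vnorm xc + mnorm (B * Dc * C) * vnorm x0 := by
    rw [hu, Matrix.mulVec_sub, Matrix.mulVec_mulVec, Matrix.mulVec_mulVec, Matrix.mulVec_mulVec]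
    exact (vnorm_sub_le' _ _).trans (add_le_add (vnorm_mulVec_le' _ _) (vnorm_mulVec_le' _ _))
  have hd : ∀ s ∈ Set.Icc (0 : ℝ) τ, HasDerivAt (fun s => WithLp.toLp 2 (x s))
      (WithLp.toLp 2 (A.mulVec (x s) + B.mulVec u + g s)) s := fun s hs =>
    ((PiLp.continuousLinearEquiv 2 ℝ (fun _ : Fin n => ℝ)).symm.toContinuousLinearMap.hasFDerivAt
      (x := x s)).comp_hasDerivAt s (hode s hs)
  have key := norm_le_gronwallBound_of_norm_deriv_right_le
    (f := fun s => WithLp.toLp 2 (x s))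
    (f' := fun s => WithLp.toLp 2 (A.mulVec (x s) + B.mulVec u + g s))
    (δ := vnorm x0) (K := L) (ε := L1 * vnorm xc + L2 * vnorm x0) (a := 0) (b := τ)
    (fun s hs => (hd s hs).continuousAt.continuousWithinAt)
    (fun s hs => (hd s ⟨hs.1, hs.2.le⟩).hasDerivWithinAt)
    (by rw [hx0]; exact le_rfl)
    (by
      intro s hs
      change vnorm (A.mulVec (x s) + B.mulVec u + g s) ≤ L * vnorm (x s) + _
      have e1 := vnorm_add_le' (A.mulVec (x s) + B.mulVec u) (g s)
      have e2 := vnorm_add_le' (A.mulVec (x s)) (B.mulVec u)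
      have e3 := vnorm_mulVec_le' A (x s)
      have e4 := hg s ⟨hs.1, hs.2.le⟩
      have e5 := mul_le_mul_of_nonneg_left hu1 hγ.le
      have e6 : 0 ≤ γ ^ 2 * mnorm Dc * vnorm x0 :=
        mul_nonneg (mul_nonneg (sq_nonneg _) (mnorm_nonneg' _)) (vnorm_nonneg' _)
      rw [hL, hL1, hL2]
      linarith) t ht
  rw [gronwallBound_of_K_ne_0 hLpos.ne'] at key
  change vnorm (x t) ≤ _ at key
  refine key.trans (le_of_eq ?_)
  rw [hh1, hh2, sub_zero]
  field_simp
  ring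
end

section
/- Let n₁ ≥ 1 and n₂ ≥ 0, set n := n₁ + n₂, let T be an invertible real n×n matrix, and let T₁ (of size n₁×n) and T₂ (of size n₂×n) denote the top and bottom row blocks of T. Let M₁ be a symmetric positive definite real n₁×n₁ matrix and M₂ any symmetric real n₂×n₂ matrix. Then for every δ > 0 there exists y ∈ ℝⁿ with 0 < ‖y‖ ≤ δ such that (T₁ y)ᵀ M₁ (T₁ y) − (T₂ y)ᵀ M₂ (T₂ y) > 0. -/
open Matrix

/-- The set of initial conditions where the indefinite Lyapunov function
`V(y) = (T₁y)ᵀM₁(T₁y) − (T₂y)ᵀM₂(T₂y)` is positive intersects every neighborhood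
of the origin, when `T` is invertible and `M₁` is positive definite. -/
theorem positive_V_near_origin {n₁ n₂ : ℕ} (hn₁ : 1 ≤ n₁)
    (T : Matrix (Fin (n₁ + n₂)) (Fin (n₁ + n₂)) ℝ) (hT : IsUnit T)
    (M₁ : Matrix (Fin n₁) (Fin n₁) ℝ) (hM₁ : M₁.PosDef)
    (M₂ : Matrix (Fin n₂) (Fin n₂) ℝ) (hM₂ : M₂.IsSymm)
    (T₁ : Matrix (Fin n₁) (Fin (n₁ + n₂)) ℝ)
    (hT₁ : T₁ = T.submatrix (Fin.castAdd n₂) id)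
    (T₂ : Matrix (Fin n₂) (Fin (n₁ + n₂)) ℝ)
    (hT₂ : T₂ = T.submatrix (Fin.natAdd n₁) id) :
    ∀ δ > 0, ∃ y : Fin (n₁ + n₂) → ℝ, 0 < vnorm y ∧ vnorm y ≤ δ ∧
      0 < T₁.mulVec y ⬝ᵥ M₁.mulVec (T₁.mulVec y)
          - T₂.mulVec y ⬝ᵥ M₂.mulVec (T₂.mulVec y) := by
  intro δ hδ
  have hδ' : (0 : ℝ) < δ := hδ
  obtain ⟨S, hS⟩ := hT.exists_right_inv
  let w : Fin (n₁ + n₂) → ℝ := Fin.append (fun _ => 1) (fun _ => 0)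
  let x : Fin (n₁ + n₂) → ℝ := S *ᵥ w
  have hTx : T *ᵥ x = w := by
    simp only [x, Matrix.mulVec_mulVec, hS, Matrix.one_mulVec]
  have h1 : T₁ *ᵥ x = fun _ => 1 := by
    ext i
    have h := congrFun hTx (Fin.castAdd n₂ i)
    simp only [w, Fin.append_left] at h
    rw [hT₁]
    exact h
  have h2 : T₂ *ᵥ x = 0 := by
    ext i
    have h := congrFun hTx (Fin.natAdd n₁ i)
    simp only [w, Fin.append_right] at h
    rw [hT₂]
    exact h
  have hone : (fun _ => 1 : Fin n₁ → ℝ) ≠ 0 := fun h => by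
    have := congrFun h ⟨0, hn₁⟩
    simp at this
  have hx : x ≠ 0 := by
    intro h
    rw [h, Matrix.mulVec_zero] at h1
    exact hone h1.symm
  have hpos := hM₁.dotProduct_mulVec_pos hone
  rw [star_trivial] at hpos
  have hnx : 0 < vnorm x := by
    unfold vnorm
    rw [norm_pos_iff]
    intro h
    apply hx
    exact congrArg (WithLp.equiv 2 (Fin (n₁ + n₂) → ℝ)) h
  have hc : 0 < δ / vnorm x := div_pos hδ' hnx
  have hn : vnorm ((δ / vnorm x) • x) = δ := by
    have : vnorm ((δ / vnorm x) • x) = ‖δ / vnorm x‖ * vnorm x := by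
      conv_rhs => rw [vnorm.eq_1 x]
      conv_lhs => rw [vnorm.eq_1]
      exact norm_smul (δ / vnorm x) ((WithLp.equiv 2 (Fin (n₁ + n₂) → ℝ)).symm x)
    rw [this, Real.norm_of_nonneg hc.le, div_mul_cancel₀ _ hnx.ne']
  refine ⟨(δ / vnorm x) • x, hn.symm ▸ hδ', hn.le, ?_⟩
  simp only [Matrix.mulVec_smul, h1, h2, smul_dotProduct, dotProduct_smul, smul_eq_mul,
    zero_dotProduct, mul_zero, sub_zero]
  exact mul_pos hc (mul_pos hc hpos)
end
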